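/- arXiv:2209.05322 — 3 statements merged into one kernel-verified Lean document; each statement's English description precedes it below -/
import Mathlib

section
/- Let H be a real Hilbert space and let (aₙ)_{n≥0} be a sequence in H such that ‖aₙ‖² = r for all n and ‖aᵢ − aⱼ‖ = δ for all i ≠ j, where δ > 0. Then the pairwise inner products ⟨aᵢ, aⱼ⟩ (i ≠ j) are all equal to r − δ²/2, and there exists v ∈ H such that (aₙ) converges weakly to v and ‖aₙ − v‖ = δ/√2 for every n. -/
open scoped InnerProductSpace

section Equilateral

variable {H : Type*} [NormedAddCommGroup H] [InnerProductSpace ℝ H]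

/-- An orthonormal sequence converges weakly to zero. -/
theorem Orthonormal.tendsto_inner_zero {e : ℕ → H} (he : Orthonormal ℝ e) (u : H) :
    Filter.Tendsto (fun n => ⟪e n, u⟫_ℝ) Filter.atTop (nhds 0) := by
  have h := (he.inner_products_summable (x := u)).tendsto_atTop_zero
  rw [tendsto_zero_iff_norm_tendsto_zero]
  simpa [Real.sqrt_sq_eq_abs] using h.sqrt

/-- The inner product of a term with an average containing it, when the Gram matrix of the
sequence is `c + d • 1`. -/
theorem inner_average_of_gram {a : ℕ → H} {c d : ℝ}
    (ha : ∀ i j, ⟪a i, a j⟫_ℝ = c + if i = j then d else 0) {i n : ℕ} (hi : i ≤ n) :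
    ⟪a i, ((n : ℝ) + 1)⁻¹ • ∑ j ∈ Finset.range (n + 1), a j⟫_ℝ = c + d / (n + 1) := by
  have hn : (n : ℝ) + 1 ≠ 0 := by positivity
  have hi' : i < n + 1 := by omega
  simp only [inner_smul_right, inner_sum, ha, Finset.sum_add_distrib, Finset.sum_const,
    Finset.card_range, nsmul_eq_mul, Finset.sum_ite_eq, Finset.mem_range, hi', if_true]
  push_cast
  field_simp

theorem inner_average_average_of_gram {a : ℕ → H} {c d : ℝ}
    (ha : ∀ i j, ⟪a i, a j⟫_ℝ = c + if i = j then d else 0) {m n : ℕ} (hmn : m ≤ n) :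
    ⟪((m : ℝ) + 1)⁻¹ • ∑ i ∈ Finset.range (m + 1), a i,
      ((n : ℝ) + 1)⁻¹ • ∑ j ∈ Finset.range (n + 1), a j⟫_ℝ = c + d / (n + 1) := by
  have hm : (m : ℝ) + 1 ≠ 0 := by positivity
  rw [real_inner_smul_left, sum_inner, Finset.sum_congr rfl fun i hi =>
    inner_average_of_gram ha ((Finset.mem_range_succ_iff.mp hi).trans hmn)]
  simp only [Finset.sum_const, Finset.card_range, nsmul_eq_mul]
  push_cast
  field_simp

/-- A sequence with Gram matrix `c + d • 1` has the same inner product `c` with the limit `v` of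
its averages, and `‖v‖² = c`. -/
theorem exists_inner_eq_of_gram [CompleteSpace H] {a : ℕ → H} {c d : ℝ} (hd : 0 ≤ d)
    (ha : ∀ i j, ⟪a i, a j⟫_ℝ = c + if i = j then d else 0) :
    ∃ v : H, (∀ i, ⟪a i, v⟫_ℝ = c) ∧ ⟪v, v⟫_ℝ = c := by
  set s : ℕ → H := fun n => ((n : ℝ) + 1)⁻¹ • ∑ j ∈ Finset.range (n + 1), a j with hs
  have hlim : Filter.Tendsto (fun n : ℕ => d / ((n : ℝ) + 1)) Filter.atTop (nhds 0) := by
    simpa [div_eq_mul_inv] using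
      (tendsto_one_div_add_atTop_nhds_zero_nat (𝕜 := ℝ)).const_mul d
  have hcauchy : CauchySeq s := by
    refine cauchySeq_of_le_tendsto_0' (fun n : ℕ => √(d / ((n : ℝ) + 1))) (fun m n hmn => ?_)
      (by simpa using hlim.sqrt)
    rw [dist_eq_norm]
    apply Real.le_sqrt_of_sq_le
    have hn : 0 ≤ d / ((n : ℝ) + 1) := by positivity
    rw [norm_sub_sq_real, ← real_inner_self_eq_norm_sq, ← real_inner_self_eq_norm_sq,
      inner_average_average_of_gram ha le_rfl, inner_average_average_of_gram ha le_rfl,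
      inner_average_average_of_gram ha hmn]
    linarith
  obtain ⟨v, hv⟩ := cauchySeq_tendsto_of_complete hcauchy
  have hlim' : Filter.Tendsto (fun n : ℕ => c + d / ((n : ℝ) + 1)) Filter.atTop (nhds c) := by
    simpa using hlim.const_add c
  refine ⟨v, fun i => tendsto_nhds_unique (tendsto_const_nhds.inner hv) (hlim'.congr' ?_),
    tendsto_nhds_unique (hv.inner hv)
      (hlim'.congr fun n => (inner_average_average_of_gram ha le_rfl).symm)⟩
  filter_upwards [Filter.eventually_ge_atTop i] with n hn
  exact (inner_average_of_gram ha hn).symm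

end Equilateral



/-- An equilateral sequence of constant norm: `‖a n‖² = r` and `‖a i - a j‖ = δ > 0` for
`i ≠ j`.  Then all pairwise inner products equal `r - δ²/2` and there is a weak limit `v`
with `‖a n - v‖ = δ/√2` for all `n`. -/
theorem stmt4 {H : Type*} [NormedAddCommGroup H] [InnerProductSpace ℝ H] [CompleteSpace H]
    (a : ℕ → H) (r δ : ℝ) (hδ : 0 < δ)
    (hnorm : ∀ n, ‖a n‖ ^ 2 = r)
    (hdist : ∀ i j, i ≠ j → ‖a i - a j‖ = δ) :
    (∀ i j, i ≠ j → ⟪a i, a j⟫_ℝ = r - δ ^ 2 / 2) ∧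
    ∃ v : H,
      (∀ u : H, Filter.Tendsto (fun n => ⟪a n, u⟫_ℝ) Filter.atTop (nhds ⟪v, u⟫_ℝ)) ∧
      (∀ n, ‖a n - v‖ = δ / Real.sqrt 2) := by
  have hinner : ∀ i j, i ≠ j → ⟪a i, a j⟫_ℝ = r - δ ^ 2 / 2 := by
    intro i j hij
    have h := norm_sub_sq_real (a i) (a j)
    rw [hdist i j hij, hnorm, hnorm] at h
    linarith
  have hgram : ∀ i j, ⟪a i, a j⟫_ℝ = (r - δ ^ 2 / 2) + if i = j then δ ^ 2 / 2 else 0 := by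
    intro i j
    split_ifs with hij
    · rw [hij, real_inner_self_eq_norm_sq, hnorm]
      ring
    · rw [hinner i j hij, add_zero]
  obtain ⟨v, hav, hvv⟩ := exists_inner_eq_of_gram (by positivity) hgram
  set t : ℝ := δ / √2 with ht
  have htpos : 0 < t := by positivity
  have htsq : t ^ 2 = δ ^ 2 / 2 := by rw [ht, div_pow, Real.sq_sqrt zero_le_two]
  have hsub : ∀ i j, ⟪a i - v, a j - v⟫_ℝ = if i = j then t ^ 2 else 0 := by
    intro i j
    rw [inner_sub_left, inner_sub_right, inner_sub_right, real_inner_comm (a j) v, hav, hav, hvv,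
      hgram, htsq]
    ring
  have horth : Orthonormal ℝ fun n => t⁻¹ • (a n - v) := by
    rw [orthonormal_iff_ite]
    intro i j
    rw [real_inner_smul_left, real_inner_smul_right, hsub]
    split_ifs
    · field_simp
    · simp
  refine ⟨hinner, v, fun u => ?_, fun n => ?_⟩
  · have h := ((horth.tendsto_inner_zero u).const_mul t).add_const ⟪v, u⟫_ℝ
    rw [mul_zero, zero_add] at h
    refine h.congr fun n => ?_
    rw [real_inner_smul_left, inner_sub_left, mul_inv_cancel_left₀ htpos.ne', sub_add_cancel]
  · rw [← sq_eq_sq₀ (norm_nonneg _) htpos.le, ← real_inner_self_eq_norm_sq, hsub, if_pos rfl]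
end

section
/- Let X be a set, let (Eₙ)_{n≥0} be a sequence of equivalence relations on X, and let h : X → ℓ²(Σ_{n∈ℕ} X/Eₙ) be defined by h(x)(n, c) = 2^{−n} if c is the Eₙ-class of x and 0 otherwise. Fix m ∈ ℕ and a sequence (x_j)_{j≥0} in X such that: for every n ≤ m, all the x_j are pairwise Eₙ-equivalent; and for every n > m, the x_j are pairwise Eₙ-inequivalent. Define h_m(x₀) ∈ ℓ²(Σ_{n∈ℕ} X/Eₙ) by h_m(x₀)(n, c) = 2^{−n} if n ≤ m and c is the Eₙ-class of x₀, and 0 otherwise. Then h(x_j) converges weakly to h_m(x₀) as j → ∞, i.e. ⟨h(x_j), u⟩ → ⟨h_m(x₀), u⟩ for every u ∈ ℓ²(Σ_{n∈ℕ} X/Eₙ). -/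
open scoped InnerProductSpace

/-- A square-summable family tends to zero along the cofinite filter. -/
theorem lp_two_tendsto_cofinite_zero {ι : Type*} (u : lp (fun _ : ι => ℝ) 2) :
    Filter.Tendsto (fun p => u p) Filter.cofinite (nhds 0) := by
  have h := (lp.summable_inner (𝕜 := ℝ) u u).tendsto_cofinite_zero
  rw [tendsto_zero_iff_norm_tendsto_zero]
  have h2 := (Real.continuous_sqrt.tendsto 0).comp h
  simpa [Function.comp_def, Real.sqrt_sq_eq_abs] using h2

/-- The inner product of a family supported on the range of an injection is the sum over the
source of the injection. -/
theorem lp_two_inner_eq_tsum {ι κ : Type*} {f : κ → ι} (hf : Function.Injective f)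
    (v u : lp (fun _ : ι => ℝ) 2) (hv : ∀ p, p ∉ Set.range f → v p = 0) :
    ⟪v, u⟫_ℝ = ∑' k, v (f k) * u (f k) := by
  rw [lp.inner_eq_tsum, ← hf.tsum_eq]
  · simp [mul_comm]
  · intro p hp
    by_contra hpf
    exact hp (by simp [hv p hpf])

open Classical in
/-- Weak limits of the images `h (x j)`: if the `x j` are pairwise `Eₙ`-equivalent for
`n ≤ m` and pairwise `Eₙ`-inequivalent for `n > m`, then `h (x j)` converges weakly to the
truncated vector `h_m (x 0)`. -/
theorem stmt12 {X : Type*} (E : ℕ → Setoid X)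
    (h : X → lp (fun _ : Σ n : ℕ, Quotient (E n) => ℝ) 2)
    (hh : ∀ (x : X) (p : Σ n : ℕ, Quotient (E n)),
      (h x : ∀ _ : Σ n : ℕ, Quotient (E n), ℝ) p =
        if p.2 = Quotient.mk (E p.1) x then ((2 : ℝ) ^ p.1)⁻¹ else 0)
    (m : ℕ) (x : ℕ → X)
    (hle : ∀ n ≤ m, ∀ i j : ℕ, (E n).r (x i) (x j))
    (hgt : ∀ n > m, ∀ i j : ℕ, i ≠ j → ¬ (E n).r (x i) (x j)) :
    ∃ g : lp (fun _ : Σ n : ℕ, Quotient (E n) => ℝ) 2,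
      (∀ p : Σ n : ℕ, Quotient (E n),
        (g : ∀ _ : Σ n : ℕ, Quotient (E n), ℝ) p =
          if p.1 ≤ m ∧ p.2 = Quotient.mk (E p.1) (x 0) then ((2 : ℝ) ^ p.1)⁻¹ else 0) ∧
      ∀ u : lp (fun _ : Σ n : ℕ, Quotient (E n) => ℝ) 2,
        Filter.Tendsto (fun j => ⟪h (x j), u⟫_ℝ) Filter.atTop (nhds ⟪g, u⟫_ℝ) := by
  have hinj : ∀ y : X, Function.Injective
      (fun n => (⟨n, Quotient.mk (E n) y⟩ : Σ n : ℕ, Quotient (E n))) :=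
    fun y a b hab => congrArg Sigma.fst hab
  have hrange : ∀ (y : X) (p : Σ n : ℕ, Quotient (E n)), p ∉ Set.range
      (fun n => (⟨n, Quotient.mk (E n) y⟩ : Σ n : ℕ, Quotient (E n))) →
      p.2 ≠ Quotient.mk (E p.1) y := by
    rintro y ⟨n, c⟩ hp hc
    exact hp ⟨n, congrArg (Sigma.mk n) hc.symm⟩
  have hmem : Memℓp (fun p : Σ n : ℕ, Quotient (E n) =>
      if p.1 ≤ m ∧ p.2 = Quotient.mk (E p.1) (x 0) then ((2 : ℝ) ^ p.1)⁻¹ else 0) 2 := by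
    refine Memℓp.of_exponent_ge (memℓp_zero ?_) (zero_le (a := (2 : ENNReal)))
    refine ((Set.finite_Iic m).image
      (fun n => (⟨n, Quotient.mk (E n) (x 0)⟩ : Σ n : ℕ, Quotient (E n)))).subset ?_
    rintro ⟨n, c⟩ hp
    simp only [Set.mem_ofPred_eq, ne_eq, ite_eq_right_iff, Classical.not_imp] at hp
    obtain ⟨⟨hn, hc⟩, -⟩ := hp
    exact ⟨n, hn, congrArg (Sigma.mk n) hc.symm⟩
  refine ⟨⟨_, hmem⟩, fun p => rfl, fun u => ?_⟩
  rw [lp_two_inner_eq_tsum (hinj (x 0)) ⟨_, hmem⟩ u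
    fun p hp => if_neg fun hq => hrange _ p hp hq.2]
  have hinner : ∀ j, ⟪h (x j), u⟫_ℝ =
      ∑' n, ((2 : ℝ) ^ n)⁻¹ * u ⟨n, Quotient.mk (E n) (x j)⟩ := by
    intro j
    rw [lp_two_inner_eq_tsum (hinj (x j)) (h (x j)) u
      fun p hp => by rw [hh, if_neg (hrange _ p hp)]]
    simp [hh]
  simp only [hinner]
  refine tendsto_tsum_of_dominated_convergence (bound := fun n => ((2 : ℝ) ^ n)⁻¹ * ‖u‖) ?_ ?_ ?_
  · simpa [inv_pow] using summable_geometric_two.mul_right ‖u‖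
  · intro n
    by_cases hn : n ≤ m
    · have hc : ∀ j, Quotient.mk (E n) (x j) = Quotient.mk (E n) (x 0) :=
        fun j => Quotient.sound (hle n hn j 0)
      simp [hc, hn]
    · have hc : Function.Injective
          (fun j => (⟨n, Quotient.mk (E n) (x j)⟩ : Σ n : ℕ, Quotient (E n))) := by
        intro i j hij
        by_contra hne
        exact hgt n (not_le.mp hn) i j hne (Quotient.exact (eq_of_heq (Sigma.mk.inj hij).2))
      have ht := (lp_two_tendsto_cofinite_zero u).comp hc.tendsto_cofinite
      rw [Nat.cofinite_eq_atTop] at ht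
      simpa [hn, Function.comp_def] using ht.const_mul ((2 : ℝ) ^ n)⁻¹
  · refine Filter.Eventually.of_forall fun j n => ?_
    rw [norm_mul, Real.norm_of_nonneg (by positivity)]
    gcongr
    exact lp.norm_apply_le_norm two_ne_zero u _
end

section
/- Let X be a set, let (Eₙ)_{n≥1} be equivalence relations on X such that Eₙ₊₁(x,y) implies Eₙ(x,y) for all n ≥ 1, and let μ : X → ℕ be a function with μ(x) ≥ 1 for all x, such that E₁(x,y) implies μ(x) = μ(y), and such that for all x, y with E₁(x,y) and all k ≥ μ(x), E_k(x,y) holds if and only if E_{μ(x)}(x,y) holds. Define f : X × X → ℝ by: f(x,y) = 0 if E₁(x,y) fails; otherwise, letting m = μ(x) and k = max{n : 1 ≤ n ≤ m and Eₙ(x,y)}, set f(x,y) = (m−1)/m + 1/(m(m+1−k)). Then f is a positive semidefinite kernel on X: for every finite list of points x₁, …, x_k in X and real numbers c₁, …, c_k, ∑_{i,j} cᵢ cⱼ f(xᵢ, xⱼ) ≥ 0. -/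
open Classical in
/-- The kernel of the paper's final lemma: `f x y = 0` if `¬ E₁(x,y)`, and otherwise
`f x y = (m-1)/m + 1/(m(m+1-k))` where `m = μ x` and
`k = max {n | 1 ≤ n ≤ m ∧ Eₙ(x,y)}`. -/
noncomputable def classKernel {X : Type*} (E : ℕ → X → X → Prop) (μ : X → ℕ)
    (x y : X) : ℝ :=
  if E 1 x y then
    ((μ x : ℝ) - 1) / (μ x : ℝ) +
      1 / ((μ x : ℝ) * ((μ x : ℝ) + 1 - ((sSup {n : ℕ | 1 ≤ n ∧ n ≤ μ x ∧ E n x y} : ℕ) : ℝ)))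
  else 0

/-- The quadratic form of the indicator of an equivalence relation is nonnegative. -/
theorem sum_sum_mul_ite_setoid_nonneg {ι : Type*} [Fintype ι] (s : Setoid ι)
    [DecidableRel s.r] (d : ι → ℝ) :
    0 ≤ ∑ i, ∑ j, d i * d j * (if s.r i j then 1 else 0) := by
  classical
  have h : ∑ i, ∑ j, d i * d j * (if s.r i j then (1 : ℝ) else 0) =
      ∑ q : Quotient s, (∑ i, if Quotient.mk s i = q then d i else 0) ^ 2 := by
    simp_rw [sq, Finset.sum_mul_sum]
    rw [Finset.sum_comm]
    simp_rw [Finset.sum_comm (s := (Finset.univ : Finset (Quotient s)))]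
    rw [Finset.sum_comm]
    refine Finset.sum_congr rfl fun i _ => Finset.sum_congr rfl fun j _ => ?_
    have hq : Quotient.mk s i = Quotient.mk s j ↔ s.r i j := Quotient.eq
    simp [ite_mul, hq]
  rw [h]
  positivity

/-- The value of `classKernel` on a pair in a class of index `m` with separation level `k`,
extended by `0` at `k = 0`. -/
noncomputable def classKernelLevel (m k : ℕ) : ℝ :=
  if k = 0 then 0 else ((m : ℝ) - 1) / m + 1 / ((m : ℝ) * ((m : ℝ) + 1 - k))

/-- The increment of `classKernelLevel m` from `n` to `n + 1`, truncated to `n < m`. -/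
noncomputable def classKernelWeight (m n : ℕ) : ℝ :=
  if n < m then classKernelLevel m (n + 1) - classKernelLevel m n else 0

theorem classKernelWeight_nonneg (m n : ℕ) : 0 ≤ classKernelWeight m n := by
  unfold classKernelWeight
  split_ifs with h
  · have hm : (1 : ℝ) ≤ m := by exact_mod_cast (by omega : 1 ≤ m)
    have hn : (n : ℝ) + 1 ≤ m := by exact_mod_cast h
    rcases Nat.eq_zero_or_pos n with rfl | hpos
    · simp only [classKernelLevel, zero_add, one_ne_zero, if_false, if_true, sub_zero]
      have h1 : 0 ≤ ((m : ℝ) - 1) / m := div_nonneg (by linarith) (by linarith)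
      have h2 : 0 ≤ 1 / ((m : ℝ) * ((m : ℝ) + 1 - (1 : ℕ))) := by
        refine div_nonneg zero_le_one (mul_nonneg (by linarith) ?_)
        push_cast
        linarith
      linarith
    · simp only [classKernelLevel, Nat.succ_ne_zero, hpos.ne', if_false]
      have h1 : 1 / ((m : ℝ) * ((m : ℝ) + 1 - n)) ≤
          1 / ((m : ℝ) * ((m : ℝ) + 1 - (n + 1 : ℕ))) := by
        push_cast
        apply one_div_le_one_div_of_le
        · exact mul_pos (by linarith) (by linarith)
        · exact mul_le_mul_of_nonneg_left (by linarith) (by linarith)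
      linarith
  · exact le_rfl

open Classical in
/-- `classKernel` is a nonnegative combination of the indicators of the relations `E (n + 1)`. -/
theorem classKernel_eq_sum {X : Type*} (E : ℕ → X → X → Prop) (μ : X → ℕ)
    (hmono : ∀ n, 1 ≤ n → ∀ x y, E (n + 1) x y → E n x y) (hμ1 : ∀ x, 1 ≤ μ x)
    {N : ℕ} {x : X} (hN : μ x ≤ N) (y : X) :
    classKernel E μ x y = ∑ n ∈ Finset.range N,
      classKernelWeight (μ x) n * (if E (n + 1) x y then 1 else 0) := by
  have hanti : ∀ a b, 1 ≤ a → a ≤ b → E b x y → E a x y := by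
    intro a b ha hab
    induction b, hab using Nat.le_induction with
    | base => exact id
    | succ b hab ih => exact fun h => ih (hmono b (ha.trans hab) x y h)
  unfold classKernel
  split_ifs with h
  · set S := {n : ℕ | 1 ≤ n ∧ n ≤ μ x ∧ E n x y}
    have hbdd : BddAbove S := ⟨μ x, fun n hn => hn.2.1⟩
    have hmem : sSup S ∈ S := Nat.sSup_mem ⟨1, le_rfl, hμ1 x, h⟩ hbdd
    obtain ⟨h1, h2, h3⟩ := hmem
    have hsub : Finset.range (sSup S) ⊆ Finset.range N :=
      Finset.range_subset_range.2 (h2.trans hN)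
    rw [← Finset.sum_subset hsub]
    · have hterm : ∀ n ∈ Finset.range (sSup S),
          classKernelWeight (μ x) n * (if E (n + 1) x y then 1 else 0) =
            classKernelLevel (μ x) (n + 1) - classKernelLevel (μ x) n := by
        intro n hn
        have hn' := Finset.mem_range.1 hn
        rw [if_pos (hanti (n + 1) _ (by omega) hn' h3), mul_one, classKernelWeight,
          if_pos (hn'.trans_le h2)]
      rw [Finset.sum_congr rfl hterm, Finset.sum_range_sub]
      rw [classKernelLevel, if_neg (Nat.one_le_iff_ne_zero.1 h1), classKernelLevel, if_pos rfl,
        sub_zero]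
    · intro n _ hn
      rw [Finset.mem_range, not_lt] at hn
      by_cases hnm : n < μ x
      · rw [if_neg, mul_zero]
        intro hE
        have := le_csSup hbdd (show n + 1 ∈ S from ⟨by omega, hnm, hE⟩)
        omega
      · rw [classKernelWeight, if_neg hnm, zero_mul]
  · refine (Finset.sum_eq_zero fun n _ => ?_).symm
    rw [if_neg fun hE => h (hanti 1 (n + 1) le_rfl (by omega) hE), mul_zero]

/-- The kernel `classKernel` is positive semidefinite, given that the `Eₙ` (`n ≥ 1`) are
decreasing equivalence relations, `μ ≥ 1` is `E₁`-invariant, and the relations stabilise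
at level `μ x` on each `E₁`-class. -/
theorem stmt13 {X : Type*} (E : ℕ → X → X → Prop) (μ : X → ℕ)
    (hE : ∀ n, 1 ≤ n → Equivalence (E n))
    (hmono : ∀ n, 1 ≤ n → ∀ x y, E (n + 1) x y → E n x y)
    (hμ1 : ∀ x, 1 ≤ μ x)
    (hμE : ∀ x y, E 1 x y → μ x = μ y)
    (hstab : ∀ x y, E 1 x y → ∀ k, μ x ≤ k → (E k x y ↔ E (μ x) x y)) :
    ∀ (k : ℕ) (x : Fin k → X) (c : Fin k → ℝ),
      0 ≤ ∑ i : Fin k, ∑ j : Fin k, c i * c j * classKernel E μ (x i) (x j) := by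
  classical
  intro k x c
  have hE1 : ∀ n, ∀ a b, E (n + 1) a b → E 1 a b := by
    intro n
    induction n with
    | zero => exact fun a b => id
    | succ n ih => exact fun a b h => ih a b (hmono (n + 1) (by omega) a b h)
  set N := Finset.univ.sup fun i => μ (x i)
  have hN : ∀ i, μ (x i) ≤ N := fun i =>
    Finset.le_sup (f := fun i => μ (x i)) (Finset.mem_univ i)
  have key : ∑ i, ∑ j, c i * c j * classKernel E μ (x i) (x j) =
      ∑ n ∈ Finset.range N, ∑ i, ∑ j,
        (c i * √(classKernelWeight (μ (x i)) n)) * (c j * √(classKernelWeight (μ (x j)) n)) *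
          (if E (n + 1) (x i) (x j) then 1 else 0) := by
    conv_rhs => rw [Finset.sum_comm]
    refine Finset.sum_congr rfl fun i _ => ?_
    conv_rhs => rw [Finset.sum_comm]
    refine Finset.sum_congr rfl fun j _ => ?_
    rw [classKernel_eq_sum E μ hmono hμ1 (hN i), Finset.mul_sum]
    refine Finset.sum_congr rfl fun n _ => ?_
    split_ifs with h
    · rw [← hμE _ _ (hE1 n _ _ h)]
      linear_combination
        -(c i * c j) * Real.mul_self_sqrt (classKernelWeight_nonneg (μ (x i)) n)
    · simp
  rw [key]
  refine Finset.sum_nonneg fun n _ => ?_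
  exact sum_sum_mul_ite_setoid_nonneg
    (Setoid.comap x ⟨E (n + 1), hE (n + 1) (by omega)⟩) _
end
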